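/- arXiv:2412.04962 — 2 statements merged into one kernel-verified Lean document; each statement's English description precedes it below -/
import Mathlib

section
/- Every vertex of the graph Y(2e,K) has degree exactly q^{4e-3} - q^{2e-2}. Equivalently: for every fixed [a] ∈ V, the number of classes [b] ∈ V with a M bᵀ ∈ J∖{0} equals q^{4e-3} - q^{2e-2}. -/
open Matrix

/-- The symplectic form `a M bᵀ` where `M = [[0, Iₑ],[-Iₑ, 0]]`. -/
def sympForm (K : Type) [CommRing K] (e : ℕ) (a b : Fin e ⊕ Fin e → K) : K :=
  a ⬝ᵥ ((Matrix.fromBlocks (0 : Matrix (Fin e) (Fin e) K) 1 (-1) 0) *ᵥ b)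

/-- `V'`: the set of 2e-tuples over `K` having at least one unit entry. -/
def unitTuples (K : Type) [CommRing K] (e : ℕ) : Set (Fin e ⊕ Fin e → K) :=
  {a | ∃ i, IsUnit (a i)}

/-- The equivalence class `[a]` of a tuple under unit scaling. -/
def cls (K : Type) [CommRing K] (e : ℕ) (a : Fin e ⊕ Fin e → K) :
    Set (Fin e ⊕ Fin e → K) :=
  {b | ∃ σ : Kˣ, b = σ • a}

/-- `V`: the set of equivalence classes of elements of `V'` under unit scaling. -/
def classes (K : Type) [CommRing K] (e : ℕ) : Set (Set (Fin e ⊕ Fin e → K)) :=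
  {S | ∃ a ∈ unitTuples K e, S = cls K e a}

/-- Adjacency in the graph `X(2e,K)`: `a M bᵀ ∈ K \ {0}`. -/
def adjX (K : Type) [CommRing K] (e : ℕ) (A B : Set (Fin e ⊕ Fin e → K)) : Prop :=
  ∃ a ∈ A, ∃ b ∈ B, sympForm K e a b ≠ 0

/-- Adjacency in the complement of `X(2e,K)`: distinct classes with `a M bᵀ = 0`. -/
def adjXc (K : Type) [CommRing K] (e : ℕ) (A B : Set (Fin e ⊕ Fin e → K)) : Prop :=
  A ≠ B ∧ ∃ a ∈ A, ∃ b ∈ B, sympForm K e a b = 0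

/-- Adjacency in the graph `Y(2e,K)`: `a M bᵀ ∈ J \ {0}`. -/
def adjY (K : Type) [CommRing K] (J : Ideal K) (e : ℕ)
    (A B : Set (Fin e ⊕ Fin e → K)) : Prop :=
  ∃ a ∈ A, ∃ b ∈ B, sympForm K e a b ∈ J ∧ sympForm K e a b ≠ 0

/-- `T = J × ⋯ × J` (2e factors), as a subset of `K^{2e}`. -/
def Tset (K : Type) [CommRing K] (J : Ideal K) (e : ℕ) : Set (Fin e ⊕ Fin e → K) :=
  {x | ∀ i, x i ∈ J}

/-- A hyperplane of `T`: a `K`-submodule contained in `T` of cardinality `q^(2e-1)`. -/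
def IsHyperplane (K : Type) [CommRing K] (J : Ideal K) (e q : ℕ)
    (H : Submodule K (Fin e ⊕ Fin e → K)) : Prop :=
  (H : Set (Fin e ⊕ Fin e → K)) ⊆ Tset K J e ∧ Nat.card H = q ^ (2 * e - 1)

/-- `C(H,u) = {[u+h] : h ∈ H}`. -/
def classSet (K : Type) [CommRing K] (e : ℕ) (H : Submodule K (Fin e ⊕ Fin e → K))
    (u : Fin e ⊕ Fin e → K) : Set (Set (Fin e ⊕ Fin e → K)) :=
  {S | ∃ h ∈ (H : Set (Fin e ⊕ Fin e → K)), S = cls K e (u + h)}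

/-- The set of tuples `{σ • (u+h) : σ ∈ Kˣ, h ∈ H}`. -/
def orbitSet (K : Type) [CommRing K] (e : ℕ) (H : Submodule K (Fin e ⊕ Fin e → K))
    (u : Fin e ⊕ Fin e → K) : Set (Fin e ⊕ Fin e → K) :=
  {x | ∃ σ : Kˣ, ∃ h ∈ (H : Set (Fin e ⊕ Fin e → K)), x = σ • (u + h)}

/-- The coset `c • u + T` of `T`. -/
def cosetOf (K : Type) [CommRing K] (J : Ideal K) (e : ℕ) (c : K)
    (u : Fin e ⊕ Fin e → K) : Set (Fin e ⊕ Fin e → K) :=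
  {x | ∃ t ∈ Tset K J e, x = c • u + t}

lemma ncard_eq_mul_of_fiber {α β : Type*} [Finite α] [Finite β] (f : α → β) {s : Set α}
    {t : Set β} {k : ℕ} (hmaps : Set.MapsTo f s t)
    (hfib : ∀ b ∈ t, {a ∈ s | f a = b}.ncard = k) : s.ncard = t.ncard * k := by
  classical
  have := Fintype.ofFinite α
  have := Fintype.ofFinite β
  rw [Set.ncard_eq_toFinset_card' s, Set.ncard_eq_toFinset_card' t,
    Finset.card_eq_sum_card_fiberwise (f := f) (t := t.toFinset) (by simpa using hmaps)]
  refine Finset.sum_const_nat fun b hb => ?_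
  rw [← hfib b (by simpa using hb), Set.ncard_eq_toFinset_card']
  congr 1
  ext a
  simp

lemma ncard_preimage_of_surjective {A B : Type*} [AddCommGroup A] [AddCommGroup B] [Finite A]
    [Finite B] (f : A →+ B) (hf : Function.Surjective f) (S : Set B) :
    (f ⁻¹' S).ncard = S.ncard * (f ⁻¹' {0}).ncard := by
  refine ncard_eq_mul_of_fiber f (fun _ h => h) fun b hb => ?_
  obtain ⟨a, rfl⟩ := hf b
  rw [← Set.ncard_image_of_injective (f ⁻¹' {0}) (add_left_injective a)]
  congr 1
  ext x
  simp only [Set.mem_preimage, Set.mem_ofPred_eq, Set.mem_image, Set.mem_singleton_iff]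
  constructor
  · rintro ⟨-, h⟩
    exact ⟨x - a, by simp [h], by simp⟩
  · rintro ⟨y, hy, rfl⟩
    simp [hy, hb]

/-- The number of tuples over a finite module `N` at which a linear form with a unit coefficient
takes values in `S`. -/
lemma ncard_linearForm_mem {K N ι : Type*} [CommRing K] [AddCommGroup N] [Module K N] [Finite N]
    [Fintype ι] (c : ι → K) (hc : ∃ i, IsUnit (c i)) (S : Set N) :
    {b : ι → N | ∑ i, c i • b i ∈ S}.ncard * Nat.card N =
      S.ncard * Nat.card N ^ Fintype.card ι := by
  classical
  let f : (ι → N) →+ N :=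
    { toFun := fun b => ∑ i, c i • b i
      map_zero' := by simp
      map_add' := fun x y => by simp [Finset.sum_add_distrib] }
  have hf : Function.Surjective f := by
    obtain ⟨i, u, hu⟩ := hc
    intro x
    refine ⟨Pi.single i ((↑u⁻¹ : K) • x), ?_⟩
    change ∑ j, c j • (Pi.single i ((↑u⁻¹ : K) • x) : ι → N) j = x
    rw [Finset.sum_eq_single i (fun j _ hj => by simp [hj]) (by simp)]
    simp [← hu, smul_smul]
  have h1 := ncard_preimage_of_surjective f hf S
  have h2 := ncard_preimage_of_surjective f hf Set.univ
  rw [Set.preimage_univ, Set.ncard_univ, Set.ncard_univ, Nat.card_fun,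
    Nat.card_eq_fintype_card (α := ι)] at h2
  change (f ⁻¹' S).ncard * _ = _
  rw [h1, h2]
  ring

section UniqueIdeal

variable {K : Type*} [CommRing K] {J : Ideal K}

lemma isUnit_iff_notMem_of_unique_ideal (hJtop : J ≠ ⊤)
    (hideals : ∀ I : Ideal K, I = ⊥ ∨ I = J ∨ I = ⊤) (x : K) : IsUnit x ↔ x ∉ J := by
  constructor
  · exact fun hx hJ => hJtop (Ideal.eq_top_of_isUnit_mem _ hJ hx)
  · intro hx
    rcases hideals (Ideal.span {x}) with h | h | h
    · rw [Ideal.span_singleton_eq_bot] at h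
      exact absurd (h ▸ J.zero_mem) hx
    · exact absurd (h ▸ Ideal.mem_span_singleton_self x) hx
    · exact Ideal.span_singleton_eq_top.1 h

lemma card_ideal_of_unique_ideal [Finite K] {r : K} (hJr : J = Ideal.span {r}) (hJbot : J ≠ ⊥)
    (hJtop : J ≠ ⊤) (hideals : ∀ I : Ideal K, I = ⊥ ∨ I = J ∨ I = ⊤) :
    Nat.card J = Nat.card (K ⧸ J) := by
  let f : K →ₗ[K] K := LinearMap.toSpanSingleton K K r
  have hrange : LinearMap.range f = J := by
    rw [hJr, Ideal.span, LinearMap.span_singleton_eq_range]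
  have hker : LinearMap.ker f = J := by
    rcases hideals (LinearMap.ker f) with h | h | h
    · have := Finite.surjective_of_injective (LinearMap.ker_eq_bot.1 h)
      exact absurd (hrange.symm.trans (LinearMap.range_eq_top.2 this)) hJtop
    · exact h
    · rw [LinearMap.ker_eq_top.1 h, LinearMap.range_zero] at hrange
      exact absurd hrange.symm hJbot
  have := Nat.card_congr f.quotKerEquivRange.toEquiv
  rw [hrange] at this
  rw [← this]
  exact Nat.card_congr (Submodule.quotEquivOfEq _ _ hker).toEquiv

lemma card_units_add_card_ideal [Finite K] (hunit : ∀ x : K, IsUnit x ↔ x ∉ J) :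
    Nat.card Kˣ + Nat.card J = Nat.card K := by
  have h1 : Nat.card Kˣ = ((J : Set K)ᶜ).ncard := by
    rw [← Set.ncard_univ, ← Set.ncard_image_of_injective _ Units.val_injective]
    congr 1
    ext x
    simpa [IsUnit] using hunit x
  rw [h1, ← Set.ncard_add_ncard_compl (J : Set K), add_comm]
  rfl

/-- The number of unimodular tuples at which a linear form takes values
in `J ∖ {0}`. -/
lemma ncard_unimodular_linearForm_mem [Finite K] {ι : Type*} [Fintype ι]
    (hunit : ∀ x : K, IsUnit x ↔ x ∉ J) (c : ι → K) :
    {b : ι → K | (∃ i, IsUnit (b i)) ∧ ∑ i, c i * b i ∈ J ∧ ∑ i, c i * b i ≠ 0}.ncard +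
      {b : ι → J | ∑ i, c i • b i ∈ ({0} : Set J)ᶜ}.ncard =
      {b : ι → K | ∑ i, c i • b i ∈ (J : Set K) \ {0}}.ncard := by
  have hinj : Function.Injective fun (b : ι → J) i => (b i : K) := fun x y h =>
    funext fun i => Subtype.ext (congrFun h i)
  rw [← Set.ncard_image_of_injective _ hinj, ← Set.ncard_union_eq]
  · congr 1
    ext b
    simp only [hunit, Set.mem_union, Set.mem_ofPred_eq, Set.mem_image, Set.mem_sdiff,
      SetLike.mem_coe, Set.mem_singleton_iff, Set.mem_compl_iff, smul_eq_mul]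
    constructor
    · rintro (h | ⟨x, hx, rfl⟩)
      · exact h.2
      · rw [← Subtype.coe_inj] at hx
        exact ⟨J.sum_mem fun i _ => J.mul_mem_left _ (x i).2, by simpa using hx⟩
    · intro h
      by_cases hb : ∃ i, b i ∉ J
      · exact Or.inl ⟨hb, h⟩
      · push Not at hb
        refine Or.inr ⟨fun i => ⟨b i, hb i⟩, ?_, rfl⟩
        rw [← Subtype.coe_inj]
        simpa using h.2
  · rw [Set.disjoint_left]
    rintro _ ⟨⟨i, hi⟩, -⟩ ⟨x, -, rfl⟩
    exact (hunit _).1 hi (x i).2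

end UniqueIdeal

section Classes

variable {K : Type} [CommRing K] {e : ℕ}

lemma sympForm_eq_sum (a b : Fin e ⊕ Fin e → K) :
    sympForm K e a b = ∑ i, Sum.elim (fun j => -a (.inr j)) (fun j => a (.inl j)) i * b i := by
  simp [sympForm, Matrix.fromBlocks_mulVec, dotProduct, Matrix.neg_mulVec, add_comm]

lemma sympForm_smul_smul (σ τ : K) (a b : Fin e ⊕ Fin e → K) :
    sympForm K e (σ • a) (τ • b) = σ * τ * sympForm K e a b := by
  simp only [sympForm, Matrix.mulVec_smul, smul_dotProduct, dotProduct_smul, smul_eq_mul]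
  ring

lemma cls_eq_cls_iff (a b : Fin e ⊕ Fin e → K) : cls K e a = cls K e b ↔ ∃ σ : Kˣ, a = σ • b := by
  constructor
  · intro h
    have : a ∈ cls K e a := ⟨1, by simp⟩
    rwa [h] at this
  · rintro ⟨σ, rfl⟩
    ext x
    constructor
    · rintro ⟨τ, rfl⟩
      exact ⟨τ * σ, by rw [mul_smul]⟩
    · rintro ⟨τ, rfl⟩
      exact ⟨τ * σ⁻¹, by rw [smul_smul, inv_mul_cancel_right]⟩

lemma adjY_cls_iff (J : Ideal K) (a b : Fin e ⊕ Fin e → K) :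
    adjY K J e (cls K e a) (cls K e b) ↔ sympForm K e a b ∈ J ∧ sympForm K e a b ≠ 0 := by
  constructor
  · rintro ⟨_, ⟨σ, rfl⟩, _, ⟨τ, rfl⟩, h⟩
    rw [Units.smul_def, Units.smul_def, sympForm_smul_smul, ← Units.val_mul] at h
    rwa [Ideal.unit_mul_mem_iff_mem _ (σ * τ).isUnit, Ne, Units.mul_right_eq_zero] at h
  · exact fun h => ⟨a, ⟨1, by simp⟩, b, ⟨1, by simp⟩, h⟩

lemma mem_unitTuples_smul_iff (σ : Kˣ) (b : Fin e ⊕ Fin e → K) :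
    σ • b ∈ unitTuples K e ↔ b ∈ unitTuples K e := by
  simp [unitTuples, Units.smul_def]

lemma ncard_cls [Finite K] {b : Fin e ⊕ Fin e → K} (hb : b ∈ unitTuples K e) :
    (cls K e b).ncard = Nat.card Kˣ := by
  have hinj : Function.Injective fun σ : Kˣ => σ • b := by
    obtain ⟨i, hi⟩ := hb
    intro σ τ h
    exact Units.ext (hi.mul_right_cancel (congrFun h i))
  rw [← Set.ncard_univ, ← Set.ncard_image_of_injective _ hinj]
  congr 1
  ext x
  simp [cls, eq_comm]

lemma ncard_tuples_eq_card_classes_mul [Finite K] (J : Ideal K) (a : Fin e ⊕ Fin e → K) :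
    {b ∈ unitTuples K e | sympForm K e a b ∈ J ∧ sympForm K e a b ≠ 0}.ncard =
      {B ∈ classes K e | adjY K J e (cls K e a) B}.ncard * Nat.card Kˣ := by
  refine ncard_eq_mul_of_fiber (cls K e)
    (fun b hb => ⟨⟨b, hb.1, rfl⟩, (adjY_cls_iff J a b).2 hb.2⟩) ?_
  rintro _ ⟨⟨b, hb, rfl⟩, hadj⟩
  rw [← ncard_cls hb]
  congr 1
  ext x
  constructor
  · exact fun h => (cls_eq_cls_iff x b).1 h.2
  · intro h
    have hx := (cls_eq_cls_iff x b).2 h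
    obtain ⟨σ, rfl⟩ := h
    exact ⟨⟨(mem_unitTuples_smul_iff σ b).2 hb, (adjY_cls_iff J a _).1 (hx ▸ hadj)⟩, hx⟩

end Classes

/-- Proposition: `Y(2e,K)` is regular of degree `q^(4e-3) - q^(2e-2)`. -/
theorem degree_Y
    (K : Type) [CommRing K] [Fintype K]
    (J : Ideal K) (r : K) (q : ℕ)
    (hJr : J = Ideal.span {r})
    (hJbot : J ≠ ⊥) (hJtop : J ≠ ⊤)
    (hideals : ∀ I : Ideal K, I = ⊥ ∨ I = J ∨ I = ⊤)
    (hq : IsPrimePow q)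
    (hqcard : Nat.card (K ⧸ J) = q)
    (e : ℕ) (he : 2 ≤ e) :
    ∀ a ∈ unitTuples K e,
      Nat.card ↥{B ∈ classes K e | adjY K J e (cls K e a) B} =
        q ^ (4 * e - 3) - q ^ (2 * e - 2) := by
  intro a ha
  have hunit := isUnit_iff_notMem_of_unique_ideal hJtop hideals
  have hcJ : Nat.card J = q := (card_ideal_of_unique_ideal hJr hJbot hJtop hideals).trans hqcard
  have hcK : Nat.card K = q * q := by
    rw [Submodule.card_eq_card_quotient_mul_card J, hqcard, hcJ]
  have hcU := card_units_add_card_ideal hunit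
  have hcount := ncard_tuples_eq_card_classes_mul J a
  rw [← Nat.card_coe_set_eq {B ∈ classes K e | _}] at hcount
  generalize Nat.card ↥{B ∈ classes K e | adjY K J e (cls K e a) B} = N at hcount ⊢
  set c : Fin e ⊕ Fin e → K := Sum.elim (fun j => -a (.inr j)) (fun j => a (.inl j)) with hc_def
  have hc : ∃ i, IsUnit (c i) := by
    obtain ⟨i | i, hi⟩ := ha
    · exact ⟨.inr i, hi⟩
    · exact ⟨.inl i, hi.neg⟩
  have hdiff := ncard_unimodular_linearForm_mem hunit c
  have hset : {b | (∃ i, IsUnit (b i)) ∧ ∑ i, c i * b i ∈ J ∧ ∑ i, c i * b i ≠ 0} =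
      {b ∈ unitTuples K e | sympForm K e a b ∈ J ∧ sympForm K e a b ≠ 0} := by
    simp only [sympForm_eq_sum, unitTuples, Set.mem_ofPred_eq, hc_def]
  rw [hset, hcount] at hdiff
  have hA := ncard_linearForm_mem c hc ((J : Set K) \ {0})
  have hB := ncard_linearForm_mem c hc (({0} : Set J)ᶜ)
  generalize {b : Fin e ⊕ Fin e → K | ∑ i, c i • b i ∈ (J : Set K) \ {0}}.ncard = A at hA hdiff
  generalize {b : Fin e ⊕ Fin e → J | ∑ i, c i • b i ∈ ({0} : Set J)ᶜ}.ncard = B at hB hdiff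
  have hS : ((J : Set K) \ {0}).ncard + 1 = q := by
    rw [Set.ncard_sdiff_singleton_add_one J.zero_mem, ← hcJ]
    rfl
  have hS' : (({0} : Set J)ᶜ).ncard + 1 = q := by
    rw [← hcJ, ← Set.ncard_add_ncard_compl ({0} : Set J), Set.ncard_singleton, add_comm]
  rw [hcK, Fintype.card_sum, Fintype.card_fin] at hA
  rw [hcJ, Fintype.card_sum, Fintype.card_fin] at hB
  rw [hcJ, hcK] at hcU
  generalize ((J : Set K) \ {0}).ncard = s at hA hS
  generalize (({0} : Set J)ᶜ).ncard = s' at hB hS'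
  generalize Nat.card Kˣ = U at *
  have hq1 := hq.one_lt
  obtain ⟨k, rfl⟩ : ∃ k, e = k + 2 := ⟨e - 2, by omega⟩
  obtain rfl : s' = s := by omega
  obtain rfl : U = s' * q := by
    have : q * q = s' * q + q := by nth_rw 1 [← hS]; ring
    omega
  have hs : 0 < s' := by omega
  have hA' : A = s' * q * q ^ (4 * (k + 2) - 3) := by
    apply Nat.eq_of_mul_eq_mul_right (show 0 < q * q by positivity)
    rw [hA, show 4 * (k + 2) - 3 = 4 * k + 5 by omega]
    ring
  have hB' : B = s' * q * q ^ (2 * (k + 2) - 2) := by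
    apply Nat.eq_of_mul_eq_mul_right (show 0 < q by positivity)
    rw [hB, show 2 * (k + 2) - 2 = 2 * k + 2 by omega]
    ring
  have hN : N + q ^ (2 * (k + 2) - 2) = q ^ (4 * (k + 2) - 3) := by
    apply Nat.eq_of_mul_eq_mul_left (show 0 < s' * q by positivity)
    rw [← hA', ← hdiff, hB']
    ring
  omega
end

section
/- Let H_1 and H_2 be hyperplanes of T and let u ∈ V' be such that r·u ∉ H_1 and r·u ∉ H_2. Then {[u+h] : h ∈ H_1} = {[u+f] : f ∈ H_2}. -/
open Matrix

section ThreeIdeals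

variable {K : Type} [CommRing K] {J : Ideal K} {r : K}

lemma isUnit_one_add_of_ideals (hJtop : J ≠ ⊤)
    (hideals : ∀ I : Ideal K, I = ⊥ ∨ I = J ∨ I = ⊤) {x : K} (hx : x ∈ J) :
    IsUnit (1 + x) := by
  by_contra hunit
  have hmem : 1 + x ∈ J := by
    rcases hideals (Ideal.span {1 + x}) with h | h | h
    · rw [Ideal.span_singleton_eq_bot] at h
      simp [h]
    · exact h ▸ Ideal.mem_span_singleton_self _
    · exact absurd (Ideal.span_singleton_eq_top.1 h) hunit
  exact hJtop ((Ideal.eq_top_iff_one J).2 (by simpa using J.sub_mem hmem hx))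

lemma generator_mul_eq_zero_of_ideals (hJr : J = Ideal.span {r}) (hJbot : J ≠ ⊥) (hJtop : J ≠ ⊤)
    (hideals : ∀ I : Ideal K, I = ⊥ ∨ I = J ∨ I = ⊤) {x : K} (hx : x ∈ J) :
    r * x = 0 := by
  have hr : r ∈ J := hJr ▸ Ideal.mem_span_singleton_self r
  rcases hideals (Ideal.span {r * x}) with h | h | h
  · exact Ideal.span_singleton_eq_bot.1 h
  · obtain ⟨c, hc⟩ := Ideal.mem_span_singleton'.1 (h ▸ hr : r ∈ Ideal.span {r * x})
    have hu := isUnit_one_add_of_ideals hJtop hideals (J.mul_mem_left (-c) hx)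
    have h0 : (1 + -c * x) * r = 0 := by linear_combination -hc
    exact absurd (by rw [hJr, hu.mul_right_eq_zero.1 h0]; simp) hJbot
  · refine absurd (top_le_iff.1 (h ▸ ?_)) hJtop
    exact (Ideal.span_singleton_le_iff_mem J).2 (J.mul_mem_left r hx)

lemma natCard_ideal_eq_natCard_quotient (hJr : J = Ideal.span {r}) (hJbot : J ≠ ⊥)
    (hJtop : J ≠ ⊤) (hideals : ∀ I : Ideal K, I = ⊥ ∨ I = J ∨ I = ⊤) :
    Nat.card J = Nat.card (K ⧸ J) := by
  have hker : LinearMap.ker (LinearMap.toSpanSingleton K K r) = J := by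
    have hle : J ≤ LinearMap.ker (LinearMap.toSpanSingleton K K r) := fun x hx => by
      simpa [mul_comm] using generator_mul_eq_zero_of_ideals hJr hJbot hJtop hideals hx
    rcases hideals (LinearMap.ker (LinearMap.toSpanSingleton K K r)) with h | h | h
    · exact absurd (le_bot_iff.1 (h ▸ hle)) hJbot
    · exact h
    · have h1 : (1 : K) ∈ LinearMap.ker (LinearMap.toSpanSingleton K K r) := h ▸ trivial
      have h0 : r = 0 := by simpa using h1
      exact absurd (by rw [hJr, h0]; simp) hJbot
  have hrange : LinearMap.range (LinearMap.toSpanSingleton K K r) = J := by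
    rw [LinearMap.range_toSpanSingleton, hJr]
  have e := (LinearMap.toSpanSingleton K K r).quotKerEquivRange
  rw [hker, hrange] at e
  exact (Nat.card_congr e.toEquiv).symm

variable {e q : ℕ} {u : Fin e ⊕ Fin e → K}

lemma cls_units_smul (σ : Kˣ) (a : Fin e ⊕ Fin e → K) : cls K e (σ • a) = cls K e a := by
  ext b
  constructor
  · rintro ⟨τ, rfl⟩
    exact ⟨τ * σ, (mul_smul τ σ a).symm⟩
  · rintro ⟨τ, rfl⟩
    exact ⟨τ * σ⁻¹, by rw [mul_smul, inv_smul_smul]⟩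

variable [Finite K]

/-- A hyperplane `H` of `T` missing `r • u` is a complement of the line `J • u` in `T`. -/
lemma IsHyperplane.exists_add_smul_eq (hJr : J = Ideal.span {r}) (hJbot : J ≠ ⊥) (hJtop : J ≠ ⊤)
    (hideals : ∀ I : Ideal K, I = ⊥ ∨ I = J ∨ I = ⊤) (hqcard : Nat.card (K ⧸ J) = q)
    (he : 1 ≤ e) {H : Submodule K (Fin e ⊕ Fin e → K)} (hH : IsHyperplane K J e q H)
    (hru : r • u ∉ H) {t : Fin e ⊕ Fin e → K} (ht : t ∈ Tset K J e) :
    ∃ h ∈ H, ∃ x ∈ J, h + x • u = t := by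
  let φ : H × J → Tset K J e := fun p =>
    ⟨p.1.1 + p.2.1 • u, fun i => J.add_mem (hH.1 p.1.2 i) (J.mul_mem_right _ p.2.2)⟩
  have hinj : Function.Injective φ := by
    rintro ⟨⟨h, hh⟩, ⟨x, hx⟩⟩ ⟨⟨h', hh'⟩, ⟨x', hx'⟩⟩ heq
    have heq : h + x • u = h' + x' • u := congrArg Subtype.val heq
    have hmem : (x - x') • u ∈ H := by
      have : (x - x') • u = h' - h := by
        rw [sub_smul, sub_eq_sub_iff_add_eq_add, add_comm, heq]
      exact this ▸ H.sub_mem hh' hh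
    have hxx : x = x' := by
      rcases hideals (Ideal.span {x - x'}) with hI | hI | hI
      · exact sub_eq_zero.1 (Ideal.span_singleton_eq_bot.1 hI)
      · have hr : r ∈ Ideal.span {x - x'} := by
          rw [hI, hJr]; exact Ideal.mem_span_singleton_self r
        obtain ⟨c, rfl⟩ := Ideal.mem_span_singleton'.1 hr
        exact absurd (by rw [mul_smul]; exact H.smul_mem c hmem) hru
      · refine absurd (top_le_iff.1 (hI ▸ ?_)) hJtop
        exact (Ideal.span_singleton_le_iff_mem J).2 (J.sub_mem hx hx')
    subst hxx
    simpa using heq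
  have hJcard : Nat.card J = q :=
    (natCard_ideal_eq_natCard_quotient hJr hJbot hJtop hideals).trans hqcard
  have hT : Nat.card (Tset K J e) = q ^ (2 * e) := by
    refine (Nat.card_congr
      (Equiv.subtypePiEquivPi (p := fun (_ : Fin e ⊕ Fin e) x => x ∈ J))).trans ?_
    rw [Nat.card_pi]
    simp [hJcard, two_mul]
  have hcard : Nat.card (H × J) = Nat.card (Tset K J e) := by
    rw [Nat.card_prod, hH.2, hJcard, hT, ← pow_succ]
    congr 1
    omega
  obtain ⟨⟨h, x⟩, hhx⟩ := ((Nat.bijective_iff_injective_and_card φ).2 ⟨hinj, hcard⟩).2 ⟨t, ht⟩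
  exact ⟨h, h.2, x, x.2, congrArg Subtype.val hhx⟩

lemma classSet_subset_of_not_mem (hJr : J = Ideal.span {r}) (hJbot : J ≠ ⊥) (hJtop : J ≠ ⊤)
    (hideals : ∀ I : Ideal K, I = ⊥ ∨ I = J ∨ I = ⊤) (hqcard : Nat.card (K ⧸ J) = q)
    (he : 1 ≤ e) {H₁ H₂ : Submodule K (Fin e ⊕ Fin e → K)}
    (hH₁ : IsHyperplane K J e q H₁) (hH₂ : IsHyperplane K J e q H₂) (hru₂ : r • u ∉ H₂) :
    classSet K e H₁ u ⊆ classSet K e H₂ u := by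
  rintro _ ⟨h, hh, rfl⟩
  obtain ⟨f, hf, x, hx, rfl⟩ :=
    hH₂.exists_add_smul_eq hJr hJbot hJtop hideals hqcard he hru₂ (hH₁.1 hh)
  obtain ⟨σ, hσ⟩ := isUnit_one_add_of_ideals hJtop hideals hx
  have hxf : x • f = 0 := by
    obtain ⟨c, rfl⟩ := Ideal.mem_span_singleton'.1 (hJr ▸ hx)
    ext i
    simp [mul_assoc, generator_mul_eq_zero_of_ideals hJr hJbot hJtop hideals (hH₂.1 hf i)]
  refine ⟨f, hf, ?_⟩
  rw [← cls_units_smul σ (u + f), Units.smul_def, hσ, add_smul, one_smul, smul_add, hxf, add_zero,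
    add_assoc]

end ThreeIdeals

/-- Lemma: if `r•u ∉ H₁ ∪ H₂` then `{[u+h] : h ∈ H₁} = {[u+f] : f ∈ H₂}`. -/
theorem classSet_eq_of_not_mem
    (K : Type) [CommRing K] [Fintype K]
    (J : Ideal K) (r : K) (q : ℕ)
    (hJr : J = Ideal.span {r})
    (hJbot : J ≠ ⊥) (hJtop : J ≠ ⊤)
    (hideals : ∀ I : Ideal K, I = ⊥ ∨ I = J ∨ I = ⊤)
    (hq : IsPrimePow q)
    (hqcard : Nat.card (K ⧸ J) = q)
    (e : ℕ) (he : 2 ≤ e)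
    (H₁ H₂ : Submodule K (Fin e ⊕ Fin e → K))
    (hH₁ : IsHyperplane K J e q H₁) (hH₂ : IsHyperplane K J e q H₂)
    (u : Fin e ⊕ Fin e → K) (hu : u ∈ unitTuples K e)
    (hru₁ : r • u ∉ H₁) (hru₂ : r • u ∉ H₂) :
    classSet K e H₁ u = classSet K e H₂ u := by
  have he' : 1 ≤ e := by omega
  exact Set.Subset.antisymm
    (classSet_subset_of_not_mem hJr hJbot hJtop hideals hqcard he' hH₁ hH₂ hru₂)
    (classSet_subset_of_not_mem hJr hJbot hJtop hideals hqcard he' hH₂ hH₁ hru₁)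
end
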